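/- Let θ > 0, δ ∈ (0, min(1/θ, 1/10)], ε ∈ (0, 1/10], and set c₀ = (5/12)θ²δ² and c₁ = (1+ε)δθ. For x, y ∈ ℝ² with ⟨x,y⟩ ≥ 0 and x∧y < 0, define p = -(9/10)|x+y|² + c₀⟨x,y⟩ + c₁(x∧y), q = (18/10)(|y|² - |x|²), and r = -(9/10)|x-y|² - c₀⟨x,y⟩ - c₁(x∧y). Then p s² + q s + r ≤ 0 for every s ∈ ℝ. -/

import Mathlib

noncomputable section

/-- `nsq x = |x|²`, the squared Euclidean norm on `ℝ²`. -/
def nsq (x : Fin 2 → ℝ) : ℝ := ∑ i, x i ^ 2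

/-- The wedge product `x∧y = x₁y₂ - x₂y₁` on `ℝ²`. -/
def wedge (x y : Fin 2 → ℝ) : ℝ := x 0 * y 1 - x 1 * y 0

/-- The Euclidean inner product `⟨x,y⟩` on `ℝ²`. -/
def dot2 (x y : Fin 2 → ℝ) : ℝ := x 0 * y 0 + x 1 * y 1

/-- `k_{tθ}(x,y) = exp(-(e^{-t}/(1-e^{-2t}))[(1-cos(tθ))⟨x,y⟩ + sin(tθ) x∧y])`. -/
def kker (t θ : ℝ) (x y : Fin 2 → ℝ) : ℝ :=
  Real.exp (-(Real.exp (-t) / (1 - Real.exp (-2 * t))) *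
    ((1 - Real.cos (t * θ)) * dot2 x y + Real.sin (t * θ) * wedge x y))

/-- `τ(s) = log((1+s)/(1-s))` for `s ∈ (0,1)`. -/
def tau (s : ℝ) : ℝ := Real.log ((1 + s) / (1 - s))

/-- `Q_s(x,y) = |(1+s)x - (1-s)y|²`. -/
def Qform (s : ℝ) (x y : Fin 2 → ℝ) : ℝ := nsq ((1 + s) • x - (1 - s) • y)

end

/-- A rotated and scaled inner product `k⟨u,v⟩ - c(u∧v)` with `k² + c² ≤ (9/5)²` is dominated by
`(9/10)(|u|² + |v|²)`. -/
lemma quadratic_form_nonneg (k c u₁ u₂ v₁ v₂ : ℝ) (h : k ^ 2 + c ^ 2 ≤ (9 / 5) ^ 2) :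
    0 ≤ 9 / 10 * (u₁ ^ 2 + u₂ ^ 2) + 9 / 10 * (v₁ ^ 2 + v₂ ^ 2) - k * (u₁ * v₁ + u₂ * v₂) +
      c * (u₁ * v₂ - u₂ * v₁) := by
  have hv : 0 ≤ ((9 / 5) ^ 2 - (k ^ 2 + c ^ 2)) * (v₁ ^ 2 + v₂ ^ 2) :=
    mul_nonneg (sub_nonneg.2 h) (by positivity)
  linarith [sq_nonneg (9 / 5 * u₁ - (k * v₁ - c * v₂)), sq_nonneg (9 / 5 * u₂ - (k * v₂ + c * v₁))]

lemma coefficients_sq_add_sq_le (a ε : ℝ) (ha : 0 ≤ a) (ha' : a ≤ 1) (hε : 0 ≤ ε)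
    (hε' : ε ≤ 1 / 10) :
    (9 / 5 - 5 / 12 * a ^ 2) ^ 2 + ((1 + ε) * a) ^ 2 ≤ (9 / 5) ^ 2 := by
  have h₁ : a ^ 2 ≤ 1 := pow_le_one₀ ha ha'
  have h₂ : (1 + ε) ^ 2 ≤ (11 / 10) ^ 2 := by gcongr; linarith
  have h₃ : a ^ 2 * a ^ 2 ≤ a ^ 2 * 1 := by gcongr
  have h₄ : (1 + ε) ^ 2 * a ^ 2 ≤ (11 / 10) ^ 2 * a ^ 2 := by gcongr
  linarith [sq_nonneg a]

/-- Let `θ > 0`, `δ ∈ (0, min(1/θ, 1/10)]`, `ε ∈ (0, 1/10]`, and set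
`c₀ = (5/12)θ²δ²`, `c₁ = (1+ε)δθ`. For `x, y ∈ ℝ²` with `⟨x,y⟩ ≥ 0` and `x∧y < 0`, with
`p = -(9/10)|x+y|² + c₀⟨x,y⟩ + c₁(x∧y)`, `q = (18/10)(|y|² - |x|²)`,
`r = -(9/10)|x-y|² - c₀⟨x,y⟩ - c₁(x∧y)`, one has `p s² + q s + r ≤ 0` for every `s ∈ ℝ`. -/
theorem quadratic_nonpositive (θ δ ε : ℝ) (hθ : 0 < θ)
    (hδ : 0 < δ) (hδ' : δ ≤ min (1 / θ) (1 / 10))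
    (hε : 0 < ε) (hε' : ε ≤ 1 / 10)
    (x y : Fin 2 → ℝ) (hxy : 0 ≤ dot2 x y) (hw : wedge x y < 0) (s : ℝ) :
    (-(9 / 10) * nsq (x + y) + (5 / 12) * θ ^ 2 * δ ^ 2 * dot2 x y +
          (1 + ε) * δ * θ * wedge x y) * s ^ 2 +
        (18 / 10) * (nsq y - nsq x) * s +
        (-(9 / 10) * nsq (x - y) - (5 / 12) * θ ^ 2 * δ ^ 2 * dot2 x y -
          (1 + ε) * δ * θ * wedge x y) ≤ 0 := by
  have ha : δ * θ ≤ 1 := (le_div_iff₀ hθ).1 (hδ'.trans (min_le_left _ _))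
  have h := quadratic_form_nonneg _ _ ((1 + s) * x 0) ((1 + s) * x 1) ((1 - s) * y 0)
    ((1 - s) * y 1) (coefficients_sq_add_sq_le (δ * θ) ε (by positivity) ha hε.le hε')
  simp only [nsq, dot2, wedge, Fin.sum_univ_two, Pi.add_apply, Pi.sub_apply]
  linarith
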